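/- The images in L(m,n) of the words in B^{xy} form a K-linear basis of L(m,n)_0^{xy}, and the images of the words in B^{yx} form a K-linear basis of L(m,n)_0^{yx}. -/

import Mathlib

open scoped BigOperators

/-- Generators of the Leavitt algebra `L(m,n)`: `Sum.inl (i,j)` is the x-letter `x_{ij}`
(`1 ≤ i ≤ m`, `1 ≤ j ≤ n`, written 0-indexed), and `Sum.inr (j,i)` is the y-letter `y_{ji}`. -/
abbrev LGen (m n : ℕ) := (Fin m × Fin n) ⊕ (Fin n × Fin m)

/-- The defining relations of the Leavitt algebra `L(m,n)`:
`∑_j x_{ij} y_{ji'} = δ_{i,i'}` and `∑_i y_{ji} x_{ij'} = δ_{j,j'}`. -/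
inductive LRel (K : Type) [Field K] (m n : ℕ) :
    FreeAlgebra K (LGen m n) → FreeAlgebra K (LGen m n) → Prop
  | xy (i i' : Fin m) :
      LRel K m n
        (∑ j : Fin n, FreeAlgebra.ι K (Sum.inl (i, j)) * FreeAlgebra.ι K (Sum.inr (j, i')))
        (if i = i' then 1 else 0)
  | yx (j j' : Fin n) :
      LRel K m n
        (∑ i : Fin m, FreeAlgebra.ι K (Sum.inr (j, i)) * FreeAlgebra.ι K (Sum.inl (i, j')))
        (if j = j' then 1 else 0)

/-- The Leavitt algebra `L(m,n)`, presented by the generators `x_{ij}, y_{ji}` and the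
relations `∑_j x_{ij} y_{ji'} = δ_{i,i'}`, `∑_i y_{ji} x_{ij'} = δ_{j,j'}`. -/
abbrev Leavitt (K : Type) [Field K] (m n : ℕ) := RingQuot (LRel K m n)

/-- The image of a generator in `L(m,n)`. -/
noncomputable def lgen (K : Type) [Field K] {m n : ℕ} (z : LGen m n) : Leavitt K m n :=
  RingQuot.mkAlgHom K (LRel K m n) (FreeAlgebra.ι K z)

/-- The generator `x_{ij}` of `L(m,n)` (0-indexed). -/
noncomputable def xg (K : Type) [Field K] {m n : ℕ} (i : Fin m) (j : Fin n) : Leavitt K m n :=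
  lgen K (Sum.inl (i, j))

/-- The generator `y_{ji}` of `L(m,n)` (0-indexed). -/
noncomputable def yg (K : Type) [Field K] {m n : ℕ} (j : Fin n) (i : Fin m) : Leavitt K m n :=
  lgen K (Sum.inr (j, i))

/-- A word over the generating set `X` of `L(m,n)`. -/
abbrev LWord (m n : ℕ) := List (LGen m n)

/-- The image of a word in `L(m,n)` (product of the images of its letters). -/
noncomputable def wordToL (K : Type) [Field K] {m n : ℕ} (w : LWord m n) : Leavitt K m n :=
  (w.map (lgen K)).prod

/-- A word is balanced if it has equally many x-letters and y-letters. -/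
def LWord.Balanced {m n : ℕ} (w : LWord m n) : Prop :=
  w.countP Sum.isLeft = w.countP Sum.isRight

/-- The degree of a word: number of x-letters minus number of y-letters. -/
def LWord.degree {m n : ℕ} (w : LWord m n) : ℤ :=
  (w.countP Sum.isLeft : ℤ) - (w.countP Sum.isRight : ℤ)

/-- The `k`-component of the canonical grading of `L(m,n)`: the `K`-linear span of the
images of all words of degree `k`. -/
noncomputable def Lcomponent (K : Type) [Field K] (m n : ℕ) (k : ℤ) :
    Submodule K (Leavitt K m n) :=
  Submodule.span K {a | ∃ w : LWord m n, w.degree = k ∧ wordToL K w = a}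

/-- A pair of consecutive letters is forbidden if it is of the form `x_{in} y_{ni'}` or
`y_{jm} x_{mj'}` (the second index of the first letter being maximal). -/
def LForbidden {m n : ℕ} (z z' : LGen m n) : Prop :=
  (∃ (i i' : Fin m) (j : Fin n), (j : ℕ) = n - 1 ∧ z = Sum.inl (i, j) ∧ z' = Sum.inr (j, i')) ∨
  (∃ (j j' : Fin n) (i : Fin m), (i : ℕ) = m - 1 ∧ z = Sum.inr (j, i) ∧ z' = Sum.inl (i, j'))

/-- A word is irreducible if it contains no forbidden subword `x_{in} y_{ni'}` or
`y_{jm} x_{mj'}`. -/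
def LWord.Irr {m n : ℕ} (w : LWord m n) : Prop :=
  ∀ (u v : LWord m n) (z z' : LGen m n), w = u ++ z :: z' :: v → ¬ LForbidden z z'

/-- A nonempty balanced word is prime if it is not the concatenation of two nonempty
balanced words. -/
def LWord.IsPrime {m n : ℕ} (w : LWord m n) : Prop :=
  w ≠ [] ∧ w.Balanced ∧ ∀ u v : LWord m n, w = u ++ v → u ≠ [] → v ≠ [] → ¬ u.Balanced

/-- An xy word: a nonempty balanced word whose first letter is an x-letter and whose
last letter is a y-letter. -/
def LWord.XY {m n : ℕ} (w : LWord m n) : Prop :=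
  w.Balanced ∧ (∃ p, w.head? = some (Sum.inl p)) ∧ (∃ q, w.getLast? = some (Sum.inr q))

/-- A yx word: a nonempty balanced word whose first letter is a y-letter and whose
last letter is an x-letter. -/
def LWord.YX {m n : ℕ} (w : LWord m n) : Prop :=
  w.Balanced ∧ (∃ q, w.head? = some (Sum.inr q)) ∧ (∃ p, w.getLast? = some (Sum.inl p))

/-- Membership in the submonoid `⟨X⟩₀^{xy}` of `⟨X⟩₀` generated by the prime xy words. -/
def LWord.InXY {m n : ℕ} (w : LWord m n) : Prop :=
  ∃ ws : List (LWord m n), (∀ u ∈ ws, u.IsPrime ∧ u.XY) ∧ ws.flatten = w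

/-- Membership in the submonoid `⟨X⟩₀^{yx}` of `⟨X⟩₀` generated by the prime yx words. -/
def LWord.InYX {m n : ℕ} (w : LWord m n) : Prop :=
  ∃ ws : List (LWord m n), (∀ u ∈ ws, u.IsPrime ∧ u.YX) ∧ ws.flatten = w

/-- The subalgebra `L(m,n)₀^{xy}` of `L(m,n)` generated by images of all prime xy words. -/
noncomputable def L0xy (K : Type) [Field K] (m n : ℕ) : Subalgebra K (Leavitt K m n) :=
  Algebra.adjoin K {a | ∃ w : LWord m n, w.IsPrime ∧ w.XY ∧ wordToL K w = a}

/-- The subalgebra `L(m,n)₀^{yx}` of `L(m,n)` generated by images of all prime yx words. -/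
noncomputable def L0yx (K : Type) [Field K] (m n : ℕ) : Subalgebra K (Leavitt K m n) :=
  Algebra.adjoin K {a | ∃ w : LWord m n, w.IsPrime ∧ w.YX ∧ wordToL K w = a}

/-- The zero component `L(m,n)₀`, as a subalgebra: it is generated (indeed spanned)
by the images of all balanced words. -/
noncomputable def L0 (K : Type) [Field K] (m n : ℕ) : Subalgebra K (Leavitt K m n) :=
  Algebra.adjoin K {a | ∃ w : LWord m n, w.Balanced ∧ wordToL K w = a}


open Finsupp

/-! ### Degrees and irreducibility of words -/

/-- The contribution of a letter to the degree of a word. -/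
def LGen.sign {m n : ℕ} (z : LGen m n) : ℤ := if z.isLeft then 1 else -1

lemma LGen.sign_eq_or {m n : ℕ} (z : LGen m n) {ε : ℤ} (hε : ε = 1 ∨ ε = -1) :
    z.sign = ε ∨ z.sign = -ε := by
  rcases z with z | z <;> rcases hε with rfl | rfl <;> simp [LGen.sign]

@[simp] lemma LWord.degree_nil {m n : ℕ} : LWord.degree ([] : LWord m n) = 0 := by
  simp [LWord.degree]

lemma LWord.degree_cons {m n : ℕ} (z : LGen m n) (w : LWord m n) :
    LWord.degree (z :: w) = z.sign + w.degree := by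
  rcases z with z | z <;> simp [LWord.degree, LGen.sign, List.countP_cons] <;> ring

lemma LWord.degree_append {m n : ℕ} (u v : LWord m n) :
    LWord.degree (u ++ v) = u.degree + v.degree := by
  simp [LWord.degree]; ring

lemma LWord.balanced_iff {m n : ℕ} (w : LWord m n) : w.Balanced ↔ w.degree = 0 := by
  simp only [LWord.Balanced, LWord.degree]; omega

lemma LWord.irr_nil {m n : ℕ} : LWord.Irr ([] : LWord m n) := by
  intro u v z z' h; simp at h

lemma LWord.irr_singleton {m n : ℕ} (z : LGen m n) : LWord.Irr [z] := by
  intro u v a b h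
  have := congrArg List.length h
  simp at this; omega

lemma LWord.irr_cons_cons {m n : ℕ} {z z' : LGen m n} {w : LWord m n} :
    LWord.Irr (z :: z' :: w) ↔ ¬ LForbidden z z' ∧ LWord.Irr (z' :: w) := by
  constructor
  · intro h
    refine ⟨h [] w z z' rfl, fun u v a b hw => h (z :: u) v a b (by rw [hw]; rfl)⟩
  · rintro ⟨h, h'⟩ u v a b hw
    rcases u with _ | ⟨c, u⟩
    · simp only [List.nil_append, List.cons.injEq] at hw
      obtain ⟨rfl, rfl, _⟩ := hw
      exact h
    · simp only [List.cons_append, List.cons.injEq] at hw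
      exact h' u v a b hw.2

lemma LWord.Irr.tail {m n : ℕ} {z : LGen m n} {w : LWord m n} (h : LWord.Irr (z :: w)) :
    w.Irr :=
  fun u v a b hw => h (z :: u) v a b (by rw [hw]; rfl)

lemma forbidden_inl_inr {m n : ℕ} {i i' : Fin m} {j j' : Fin n} :
    LForbidden (Sum.inl (i, j)) (Sum.inr (j', i')) ↔ j = j' ∧ (j : ℕ) = n - 1 := by
  constructor
  · rintro (⟨a, b, c, hc, h1, h2⟩ | ⟨a, b, c, hc, h1, h2⟩)
    · simp only [Sum.inl.injEq, Sum.inr.injEq, Prod.mk.injEq] at h1 h2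
      rw [h1.2, h2.1]; exact ⟨rfl, hc⟩
    · simp at h1
  · rintro ⟨rfl, h⟩
    exact Or.inl ⟨i, i', j, h, rfl, rfl⟩

lemma forbidden_inr_inl {m n : ℕ} {i i' : Fin m} {j j' : Fin n} :
    LForbidden (Sum.inr (j, i)) (Sum.inl (i', j')) ↔ i = i' ∧ (i : ℕ) = m - 1 := by
  constructor
  · rintro (⟨a, b, c, hc, h1, h2⟩ | ⟨a, b, c, hc, h1, h2⟩)
    · simp at h1
    · simp only [Sum.inl.injEq, Sum.inr.injEq, Prod.mk.injEq] at h1 h2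
      rw [h1.2, h2.1]; exact ⟨rfl, hc⟩
  · rintro ⟨rfl, h⟩
    exact Or.inr ⟨j, j', i, h, rfl, rfl⟩

lemma not_forbidden_inl_inl {m n : ℕ} {p q : Fin m × Fin n} :
    ¬ LForbidden (Sum.inl p : LGen m n) (Sum.inl q) := by
  rintro (⟨a, b, c, hc, h1, h2⟩ | ⟨a, b, c, hc, h1, h2⟩) <;> simp at h1 h2

lemma not_forbidden_inr_inr {m n : ℕ} {p q : Fin n × Fin m} :
    ¬ LForbidden (Sum.inr p : LGen m n) (Sum.inr q) := by
  rintro (⟨a, b, c, hc, h1, h2⟩ | ⟨a, b, c, hc, h1, h2⟩) <;> simp at h1 h2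

/-- Irreducibility does not depend on the first index of the leading x-letter. -/
lemma LWord.Irr.inl_congr {m n : ℕ} {i i' : Fin m} {j : Fin n} {w : LWord m n}
    (h : LWord.Irr (Sum.inl (i, j) :: w)) : LWord.Irr (Sum.inl (i', j) :: w) := by
  rcases w with _ | ⟨p | ⟨a, b⟩, w⟩
  · exact irr_singleton _
  · exact irr_cons_cons.2 ⟨not_forbidden_inl_inl, h.tail⟩
  · rw [irr_cons_cons, forbidden_inl_inr] at h ⊢
    exact h

/-- Irreducibility does not depend on the first index of the leading y-letter. -/
lemma LWord.Irr.inr_congr {m n : ℕ} {i : Fin m} {j j' : Fin n} {w : LWord m n}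
    (h : LWord.Irr (Sum.inr (j, i) :: w)) : LWord.Irr (Sum.inr (j', i) :: w) := by
  rcases w with _ | ⟨⟨a, b⟩ | p, w⟩
  · exact irr_singleton _
  · rw [irr_cons_cons, forbidden_inr_inl] at h ⊢
    exact h
  · exact irr_cons_cons.2 ⟨not_forbidden_inr_inr, h.tail⟩

/-! ### Left multiplication on the span of irreducible words -/

section Action

variable (K : Type) [Field K] {m n : ℕ}

/-- One rewriting step applied to the two leading letters of `z :: z' :: w`. -/
noncomputable def contract : LGen m n → LGen m n → LWord m n → (LWord m n →₀ K)
  | Sum.inl (i, j), Sum.inr (j', i'), w =>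
      if j = j' ∧ (j : ℕ) = n - 1 then
        (if i = i' then single w 1 else 0) -
          ∑ k ∈ Finset.univ.erase j, single (Sum.inl (i, k) :: Sum.inr (k, i') :: w) 1
      else single (Sum.inl (i, j) :: Sum.inr (j', i') :: w) 1
  | Sum.inr (j, i), Sum.inl (i', j'), w =>
      if i = i' ∧ (i : ℕ) = m - 1 then
        (if j = j' then single w 1 else 0) -
          ∑ k ∈ Finset.univ.erase i, single (Sum.inr (j, k) :: Sum.inl (k, j') :: w) 1
      else single (Sum.inr (j, i) :: Sum.inl (i', j') :: w) 1
  | z, z', w => single (z :: z' :: w) 1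

/-- Left multiplication of a word by a letter, followed by one rewriting step. -/
noncomputable def mulWord (z : LGen m n) : LWord m n → (LWord m n →₀ K)
  | [] => single [z] 1
  | z' :: w => contract K z z' w

lemma mulWord_cons (z z' : LGen m n) (w : LWord m n) :
    mulWord K z (z' :: w) = contract K z z' w := rfl

/-- The linear extension of `mulWord`. -/
noncomputable def mulLetter (z : LGen m n) : (LWord m n →₀ K) →ₗ[K] (LWord m n →₀ K) :=
  Finsupp.linearCombination K (mulWord K z)

@[simp] lemma mulLetter_single (z : LGen m n) (w : LWord m n) :
    mulLetter K z (single w 1) = mulWord K z w := by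
  simp [mulLetter]

lemma mulWord_of_irr {z : LGen m n} {w : LWord m n} (h : LWord.Irr (z :: w)) :
    mulWord K z w = single (z :: w) 1 := by
  rcases w with _ | ⟨z', w⟩
  · rfl
  · rw [LWord.irr_cons_cons] at h
    rcases z with ⟨i, j⟩ | ⟨j, i⟩ <;> rcases z' with ⟨a, b⟩ | ⟨a, b⟩
    · rfl
    · rw [forbidden_inl_inr] at h
      simp only [mulWord, contract, if_neg h.1]
    · rw [forbidden_inr_inl] at h
      simp only [mulWord, contract, if_neg h.1]
    · rfl

lemma sum_contract_inl_inr (hn : 0 < n) (i i' : Fin m) (w : LWord m n) :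
    ∑ j : Fin n, contract K (Sum.inl (i, j)) (Sum.inr (j, i')) w =
      if i = i' then single w 1 else 0 := by
  let l : Fin n := ⟨n - 1, by omega⟩
  rw [← Finset.add_sum_erase _ _ (Finset.mem_univ l), Finset.sum_congr rfl
    (g := fun k => single (Sum.inl (i, k) :: Sum.inr (k, i') :: w) (1 : K))]
  · simp [contract, l]
  · intro k hk
    have hk' : ¬ (k : ℕ) = n - 1 := fun h => (Finset.mem_erase.1 hk).1 (Fin.ext h)
    simp [contract, hk']

lemma sum_contract_inr_inl (hm : 0 < m) (j j' : Fin n) (w : LWord m n) :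
    ∑ i : Fin m, contract K (Sum.inr (j, i)) (Sum.inl (i, j')) w =
      if j = j' then single w 1 else 0 := by
  let l : Fin m := ⟨m - 1, by omega⟩
  rw [← Finset.add_sum_erase _ _ (Finset.mem_univ l), Finset.sum_congr rfl
    (g := fun k => single (Sum.inr (j, k) :: Sum.inl (k, j') :: w) (1 : K))]
  · simp [contract, l]
  · intro k hk
    have hk' : ¬ (k : ℕ) = m - 1 := fun h => (Finset.mem_erase.1 hk).1 (Fin.ext h)
    simp [contract, hk']

lemma sum_mulLetter_inl_inr (hn : 0 < n) (i i' : Fin m) {w : LWord m n} (hw : w.Irr) :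
    ∑ j : Fin n, mulLetter K (Sum.inl (i, j)) (mulWord K (Sum.inr (j, i')) w) =
      if i = i' then single w 1 else 0 := by
  by_cases h : ∀ j, LWord.Irr (Sum.inr (j, i') :: w)
  · simp only [mulWord_of_irr K (h _), mulLetter_single]
    exact sum_contract_inl_inr K hn i i' w
  · rcases w with _ | ⟨⟨a, b⟩ | p, w⟩
    · exact absurd (fun j => LWord.irr_singleton _) h
    · simp only [LWord.irr_cons_cons, forbidden_inr_inl, hw, and_true, not_forall,
        not_not] at h
      obtain ⟨-, rfl, hi'⟩ := h
      have hy (j : Fin n) : mulWord K (Sum.inr (j, i')) (Sum.inl (i', b) :: w) =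
          (if j = b then single w 1 else 0) -
            ∑ k ∈ Finset.univ.erase i', single (Sum.inr (j, k) :: Sum.inl (k, b) :: w) 1 := by
        simp [mulWord, contract, hi']
      simp only [hy, map_sub, map_sum, mulLetter_single, Finset.sum_sub_distrib]
      rw [Finset.sum_comm]
      simp only [mulWord_cons, sum_contract_inl_inr K hn]
      simp only [apply_ite (mulLetter K _), mulLetter_single, map_zero,
        Finset.sum_ite_eq', Finset.mem_univ, if_true, mulWord_of_irr K (LWord.Irr.inl_congr hw),
        Finset.sum_ite_eq, Finset.mem_erase, and_true]
      by_cases h : i = i' <;> simp [h]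
    · exact absurd (fun j => LWord.irr_cons_cons.2 ⟨not_forbidden_inr_inr, hw⟩) h

lemma sum_mulLetter_inr_inl (hm : 0 < m) (j j' : Fin n) {w : LWord m n} (hw : w.Irr) :
    ∑ i : Fin m, mulLetter K (Sum.inr (j, i)) (mulWord K (Sum.inl (i, j')) w) =
      if j = j' then single w 1 else 0 := by
  by_cases h : ∀ i, LWord.Irr (Sum.inl (i, j') :: w)
  · simp only [mulWord_of_irr K (h _), mulLetter_single]
    exact sum_contract_inr_inl K hm j j' w
  · rcases w with _ | ⟨p | ⟨b, a⟩, w⟩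
    · exact absurd (fun j => LWord.irr_singleton _) h
    · exact absurd (fun j => LWord.irr_cons_cons.2 ⟨not_forbidden_inl_inl, hw⟩) h
    · simp only [LWord.irr_cons_cons, forbidden_inl_inr, hw, and_true, not_forall,
        not_not] at h
      obtain ⟨-, rfl, hj'⟩ := h
      have hx (i : Fin m) : mulWord K (Sum.inl (i, j')) (Sum.inr (j', a) :: w) =
          (if i = a then single w 1 else 0) -
            ∑ k ∈ Finset.univ.erase j', single (Sum.inl (i, k) :: Sum.inr (k, a) :: w) 1 := by
        simp [mulWord, contract, hj']
      simp only [hx, map_sub, map_sum, mulLetter_single, Finset.sum_sub_distrib]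
      rw [Finset.sum_comm]
      simp only [mulWord_cons, sum_contract_inr_inl K hm]
      simp only [apply_ite (mulLetter K _), mulLetter_single, map_zero,
        Finset.sum_ite_eq', Finset.mem_univ, if_true, mulWord_of_irr K (LWord.Irr.inr_congr hw),
        Finset.sum_ite_eq, Finset.mem_erase, and_true]
      by_cases h : j = j' <;> simp [h]


/-- Every nonempty suffix of the word has degree of sign opposite to `ε` (or zero). -/
def LWord.SuffixSign (ε : ℤ) : LWord m n → Prop
  | [] => True
  | z :: w => ε * LWord.degree (z :: w) ≤ 0 ∧ LWord.SuffixSign ε w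

/-- The irreducible words that may occur in the normal form of `w`. -/
def normalWords (w : LWord m n) : Set (LWord m n) :=
  {v | v.Irr ∧ v.degree = w.degree ∧ ∀ ε, LWord.SuffixSign ε w → LWord.SuffixSign ε v}

lemma mulWord_mem_supported (z : LGen m n) {w : LWord m n} (hw : w.Irr) :
    mulWord K z w ∈ Finsupp.supported K K (normalWords (z :: w)) := by
  by_cases hz : LWord.Irr (z :: w)
  · rw [mulWord_of_irr K hz]
    exact Finsupp.single_mem_supported K _ ⟨hz, rfl, fun _ h => h⟩
  rcases w with _ | ⟨z', w⟩
  · exact absurd (LWord.irr_singleton z) hz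
  rw [LWord.irr_cons_cons, not_and_or, not_not, or_iff_left (not_not.2 hw)] at hz
  rcases z with ⟨i, j⟩ | ⟨j, i⟩ <;> rcases z' with ⟨a, b⟩ | ⟨a, b⟩
  · exact absurd hz not_forbidden_inl_inl
  · rw [forbidden_inl_inr] at hz
    rw [mulWord_cons, contract, if_pos hz]
    obtain ⟨rfl, hj⟩ := hz
    refine Submodule.sub_mem _ ?_ (Submodule.sum_mem _ fun k hk => ?_)
    · split_ifs
      · refine Finsupp.single_mem_supported K _ ⟨hw.tail, ?_, fun ε h => h.2.2⟩
        simp [LWord.degree_cons, LGen.sign]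
      · exact Submodule.zero_mem _
    · refine Finsupp.single_mem_supported K _ ⟨?_, ?_, fun ε h => ?_⟩
      · refine LWord.irr_cons_cons.2 ⟨?_, hw.inr_congr⟩
        rw [forbidden_inl_inr]
        exact fun h => (Finset.mem_erase.1 hk).1 (Fin.ext (h.2.trans hj.symm))
      · simp [LWord.degree_cons, LGen.sign]
      · simpa [LWord.SuffixSign, LWord.degree_cons, LGen.sign] using h
  · rw [forbidden_inr_inl] at hz
    rw [mulWord_cons, contract, if_pos hz]
    obtain ⟨rfl, hi⟩ := hz
    refine Submodule.sub_mem _ ?_ (Submodule.sum_mem _ fun k hk => ?_)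
    · split_ifs
      · refine Finsupp.single_mem_supported K _ ⟨hw.tail, ?_, fun ε h => h.2.2⟩
        simp [LWord.degree_cons, LGen.sign]
      · exact Submodule.zero_mem _
    · refine Finsupp.single_mem_supported K _ ⟨?_, ?_, fun ε h => ?_⟩
      · refine LWord.irr_cons_cons.2 ⟨?_, hw.inl_congr⟩
        rw [forbidden_inr_inl]
        exact fun h => (Finset.mem_erase.1 hk).1 (Fin.ext (h.2.trans hi.symm))
      · simp [LWord.degree_cons, LGen.sign]
      · simpa [LWord.SuffixSign, LWord.degree_cons, LGen.sign] using h
  · exact absurd hz not_forbidden_inr_inr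

/-! ### Linear independence of irreducible words -/

/-- The span of the irreducible words. -/
noncomputable abbrev irrSpan (m n : ℕ) : Submodule K (LWord m n →₀ K) :=
  Finsupp.supported K K {w | w.Irr}

lemma mulLetter_mem_irrSpan (z : LGen m n) :
    ∀ f ∈ irrSpan K m n, mulLetter K z f ∈ irrSpan K m n := by
  change irrSpan K m n ≤ (irrSpan K m n).comap (mulLetter K z)
  conv_lhs => rw [irrSpan, Finsupp.supported_eq_span_single]
  rw [Submodule.span_le]
  rintro _ ⟨w, hw, rfl⟩
  change mulLetter K z (single w 1) ∈ irrSpan K m n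
  rw [mulLetter_single]
  exact Finsupp.supported_mono (fun v hv => hv.1) (mulWord_mem_supported K z hw)

/-- Left multiplication by a letter, acting on the span of the irreducible words. -/
noncomputable def mulIrr (z : LGen m n) : Module.End K (irrSpan K m n) :=
  (mulLetter K z).restrict (mulLetter_mem_irrSpan K z)

lemma mulIrr_ext {f g : Module.End K (irrSpan K m n)}
    (h : ∀ (w : LWord m n) (hw : w.Irr),
      (f ⟨single w 1, Finsupp.single_mem_supported K 1 hw⟩ : LWord m n →₀ K) =
        g ⟨single w 1, Finsupp.single_mem_supported K 1 hw⟩) : f = g := by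
  ext1 ⟨v, hv⟩
  have key : ∀ v (hv : v ∈ Submodule.span K
      ((fun w : LWord m n => single w (1 : K)) '' {w | w.Irr})) (hv' : v ∈ irrSpan K m n),
      f ⟨v, hv'⟩ = g ⟨v, hv'⟩ := by
    intro v hv
    induction hv using Submodule.span_induction with
    | mem x hx =>
      obtain ⟨w, hw, rfl⟩ := hx
      exact fun _ => Subtype.ext (h w hw)
    | zero => exact fun h0 => (map_zero f).trans (map_zero g).symm
    | add x y hx hy ihx ihy =>
      rw [← Finsupp.supported_eq_span_single] at hx hy
      intro _
      exact (map_add f ⟨x, hx⟩ ⟨y, hy⟩).trans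
        ((congrArg₂ (· + ·) (ihx hx) (ihy hy)).trans (map_add g ⟨x, hx⟩ ⟨y, hy⟩).symm)
    | smul a x hx ihx =>
      rw [← Finsupp.supported_eq_span_single] at hx
      intro _
      exact (map_smul f a ⟨x, hx⟩).trans
        ((congrArg (a • ·) (ihx hx)).trans (map_smul g a ⟨x, hx⟩).symm)
  refine key v ?_ hv
  rwa [← Finsupp.supported_eq_span_single]

/-- The representation of `L(m,n)` on the span of the irreducible words. -/
noncomputable def irrRep (hm : 0 < m) (hn : 0 < n) :
    Leavitt K m n →ₐ[K] Module.End K (irrSpan K m n) :=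
  RingQuot.liftAlgHom K ⟨FreeAlgebra.lift K (mulIrr K), by
    rintro _ _ (⟨i, i'⟩ | ⟨j, j'⟩)
    · simp only [map_sum, map_mul, FreeAlgebra.lift_ι_apply]
      refine mulIrr_ext K fun w hw => ?_
      simpa [mulIrr, apply_ite, ite_apply] using
        sum_mulLetter_inl_inr K hn i i' hw
    · simp only [map_sum, map_mul, FreeAlgebra.lift_ι_apply]
      refine mulIrr_ext K fun w hw => ?_
      simpa [mulIrr, apply_ite, ite_apply] using
        sum_mulLetter_inr_inl K hm j j' hw⟩

lemma irrRep_lgen (hm : 0 < m) (hn : 0 < n) (z : LGen m n) :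
    irrRep K hm hn (lgen K z) = mulIrr K z := by
  simp [irrRep, lgen]

lemma wordToL_cons (z : LGen m n) (w : LWord m n) :
    wordToL K (z :: w) = lgen K z * wordToL K w := by
  simp [wordToL]

lemma wordToL_append (u v : LWord m n) :
    wordToL K (u ++ v) = wordToL K u * wordToL K v := by
  simp [wordToL]

lemma irrRep_wordToL (hm : 0 < m) (hn : 0 < n) {w : LWord m n} (hw : w.Irr) :
    (irrRep K hm hn (wordToL K w)
      ⟨single [] 1, Finsupp.single_mem_supported K 1 LWord.irr_nil⟩ : LWord m n →₀ K) =
      single w 1 := by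
  induction w with
  | nil => simp [wordToL]
  | cons z w ih =>
    rw [wordToL_cons, map_mul, irrRep_lgen, Module.End.mul_apply, mulIrr,
      LinearMap.coe_restrict_apply, ih hw.tail, mulLetter_single, mulWord_of_irr K hw]

lemma linearIndependent_irr (hm : 0 < m) (hn : 0 < n) :
    LinearIndependent K (fun w : {w : LWord m n // w.Irr} => wordToL K w.1) := by
  let φ : Leavitt K m n →ₗ[K] (LWord m n →₀ K) :=
    (irrSpan K m n).subtype ∘ₗ
      (LinearMap.applyₗ ⟨single [] 1, Finsupp.single_mem_supported K 1 LWord.irr_nil⟩) ∘ₗ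
      (irrRep K hm hn).toLinearMap
  refine LinearIndependent.of_comp φ ?_
  have : φ ∘ (fun w : {w : LWord m n // w.Irr} => wordToL K w.1) =
      (fun w : LWord m n => single w (1 : K)) ∘ Subtype.val :=
    funext fun w => irrRep_wordToL K hm hn w.2
  rw [this]
  exact (Finsupp.linearIndependent_single_one K (LWord m n)).comp _ Subtype.val_injective

/-! ### Normal forms span -/

lemma sum_lgen_inl_inr (i i' : Fin m) :
    ∑ j : Fin n, lgen K (Sum.inl (i, j)) * lgen K (Sum.inr (j, i')) =
      if i = i' then (1 : Leavitt K m n) else 0 := by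
  have := RingQuot.mkAlgHom_rel K (LRel.xy (K := K) (n := n) i i')
  simpa [lgen, apply_ite] using this

lemma sum_lgen_inr_inl (j j' : Fin n) :
    ∑ i : Fin m, lgen K (Sum.inr (j, i)) * lgen K (Sum.inl (i, j')) =
      if j = j' then (1 : Leavitt K m n) else 0 := by
  have := RingQuot.mkAlgHom_rel K (LRel.yx (K := K) (m := m) j j')
  simpa [lgen, apply_ite] using this

lemma linearCombination_contract (z z' : LGen m n) (w : LWord m n) :
    Finsupp.linearCombination K (wordToL K) (contract K z z' w) = wordToL K (z :: z' :: w) := by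
  rcases z with ⟨i, j⟩ | ⟨j, i⟩ <;> rcases z' with ⟨a, b⟩ | ⟨a, b⟩
  · simp [contract]
  · rw [contract]
    split_ifs with h h'
    · obtain ⟨rfl, -⟩ := h
      simp [wordToL_cons, ← mul_assoc, ← Finset.sum_mul, sum_lgen_inl_inr, h']
    · obtain ⟨rfl, -⟩ := h
      simp [wordToL_cons, ← mul_assoc, ← Finset.sum_mul, sum_lgen_inl_inr, h']
    · simp
  · rw [contract]
    split_ifs with h h'
    · obtain ⟨rfl, -⟩ := h
      simp [wordToL_cons, ← mul_assoc, ← Finset.sum_mul, sum_lgen_inr_inl, h']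
    · obtain ⟨rfl, -⟩ := h
      simp [wordToL_cons, ← mul_assoc, ← Finset.sum_mul, sum_lgen_inr_inl, h']
    · simp
  · simp [contract]

lemma linearCombination_mulWord (z : LGen m n) (w : LWord m n) :
    Finsupp.linearCombination K (wordToL K) (mulWord K z w) = wordToL K (z :: w) := by
  rcases w with _ | ⟨z', w⟩
  · simp [mulWord]
  · exact linearCombination_contract K z z' w

lemma normalWords_cons {z : LGen m n} {v w : LWord m n} (hv : v ∈ normalWords w) :
    normalWords (z :: v) ⊆ normalWords (z :: w) := by
  rintro u ⟨hu, hd, hs⟩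
  have hdeg : LWord.degree (z :: v) = LWord.degree (z :: w) := by
    rw [LWord.degree_cons, LWord.degree_cons, hv.2.1]
  exact ⟨hu, hd.trans hdeg, fun ε h => hs ε ⟨hdeg ▸ h.1, hv.2.2 ε h.2⟩⟩

lemma wordToL_mem_span_normalWords (w : LWord m n) :
    wordToL K w ∈ Submodule.span K (wordToL K '' normalWords w) := by
  induction w with
  | nil => exact Submodule.subset_span ⟨[], ⟨LWord.irr_nil, rfl, fun _ h => h⟩, rfl⟩
  | cons z w ih =>
    have hle : Submodule.span K (wordToL K '' normalWords w) ≤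
        (Submodule.span K (wordToL K '' normalWords (z :: w))).comap
          (LinearMap.mulLeft K (lgen K z)) := by
      rw [Submodule.span_le]
      rintro _ ⟨v, hv, rfl⟩
      change lgen K z * wordToL K v ∈ Submodule.span K (wordToL K '' normalWords (z :: w))
      rw [← wordToL_cons, ← linearCombination_mulWord, Finsupp.span_image_eq_map_linearCombination]
      exact Submodule.mem_map_of_mem
        (Finsupp.supported_mono (normalWords_cons hv) (mulWord_mem_supported K z hv.1))
    rw [wordToL_cons]
    exact hle ih

end Action

/-! ### Factorization into prime words -/

section Prime

variable {m n : ℕ}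

/-- A prime word with first letter of sign `ε` and last letter of sign `-ε`. -/
def LWord.PrimeSign (ε : ℤ) (w : LWord m n) : Prop :=
  w.IsPrime ∧ (∃ z, w.head? = some z ∧ z.sign = ε) ∧ ∃ z, w.getLast? = some z ∧ z.sign = -ε

/-- A concatenation of prime words of type `ε`. -/
def LWord.InSign (ε : ℤ) (w : LWord m n) : Prop :=
  ∃ ws : List (LWord m n), (∀ u ∈ ws, LWord.PrimeSign ε u) ∧ ws.flatten = w

lemma LWord.primeSign_one_iff (w : LWord m n) : w.PrimeSign 1 ↔ w.IsPrime ∧ w.XY := by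
  simp only [PrimeSign, XY, LGen.sign]
  refine and_congr_right fun h => ?_
  simp [h.2.1]

lemma LWord.primeSign_neg_one_iff (w : LWord m n) : w.PrimeSign (-1) ↔ w.IsPrime ∧ w.YX := by
  simp only [PrimeSign, YX, LGen.sign]
  refine and_congr_right fun h => ?_
  simp [h.2.1]

lemma LWord.inSign_one : LWord.InSign 1 = LWord.InXY (m := m) (n := n) := by
  funext w
  simp only [InSign, InXY, primeSign_one_iff]

lemma LWord.inSign_neg_one : LWord.InSign (-1) = LWord.InYX (m := m) (n := n) := by
  funext w
  simp only [InSign, InYX, primeSign_neg_one_iff]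

lemma LWord.suffixSign_append {ε : ℤ} {u v : LWord m n} (hv : v.degree = 0) :
    LWord.SuffixSign ε (u ++ v) ↔ LWord.SuffixSign ε u ∧ LWord.SuffixSign ε v := by
  induction u with
  | nil => simp [SuffixSign]
  | cons z u ih =>
    rw [List.cons_append, SuffixSign, SuffixSign, ih, ← List.cons_append, degree_append, hv,
      add_zero, and_assoc]

lemma LWord.SuffixSign.of_append {ε : ℤ} {u v : LWord m n}
    (h : LWord.SuffixSign ε (u ++ v)) : LWord.SuffixSign ε v := by
  induction u with
  | nil => exact h
  | cons z u ih => exact ih h.2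

lemma LWord.PrimeSign.prefix_pos {ε : ℤ} (hε : ε = 1 ∨ ε = -1) {w : LWord m n}
    (hw : w.PrimeSign ε) (p : LWord m n) :
    ∀ q, w = p ++ q → p ≠ [] → q ≠ [] → 0 < ε * p.degree := by
  induction p using List.reverseRecOn with
  | nil => exact fun q _ h => absurd rfl h
  | append_singleton p z ih =>
    intro q hq _ hq0
    rcases eq_or_ne p [] with rfl | hp
    · obtain ⟨z', hz', hs⟩ := hw.2.1
      rw [hq] at hz'
      simp only [List.nil_append, List.cons_append, List.head?_cons, Option.some.injEq] at hz'
      subst hz'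
      rcases hε with rfl | rfl <;> simp [degree_cons, hs]
    · have h1 := ih ([z] ++ q) (by simpa using hq) hp (by simp)
      have h2 : ¬ LWord.Balanced (p ++ [z]) := hw.1.2.2 (p ++ [z]) q hq (by simp) hq0
      rw [balanced_iff] at h2
      rw [degree_append, degree_cons, degree_nil] at h2 ⊢
      rcases hε with rfl | rfl <;> rcases z.sign_eq_or (Or.inl rfl) with hz | hz <;>
        rw [hz] at h2 ⊢ <;> omega

lemma LWord.PrimeSign.suffixSign {ε : ℤ} (hε : ε = 1 ∨ ε = -1) {w : LWord m n}
    (hw : w.PrimeSign ε) : LWord.SuffixSign ε w := by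
  have hdeg := (balanced_iff w).1 hw.1.2.1
  have key : ∀ q p : LWord m n, w = p ++ q → LWord.SuffixSign ε q := by
    intro q
    induction q with
    | nil => exact fun _ _ => trivial
    | cons z q ih =>
      intro p hp
      refine ⟨?_, ih (p ++ [z]) (by simpa using hp)⟩
      rcases eq_or_ne p [] with rfl | hp0
      · rw [List.nil_append] at hp
        rw [← hp, hdeg, mul_zero]
      · have h1 := hw.prefix_pos hε p (z :: q) hp hp0 (by simp)
        rw [hp, degree_append] at hdeg
        rw [eq_neg_of_add_eq_zero_right hdeg]
        linarith
  exact key w [] rfl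

lemma LWord.InSign.append {ε : ℤ} {u v : LWord m n} (hu : u.InSign ε) (hv : v.InSign ε) :
    (u ++ v).InSign ε := by
  obtain ⟨us, hus, rfl⟩ := hu
  obtain ⟨vs, hvs, rfl⟩ := hv
  refine ⟨us ++ vs, fun w hw => ?_, by simp⟩
  exact (List.mem_append.1 hw).elim (hus w) (hvs w)

lemma LWord.PrimeSign.inSign {ε : ℤ} {w : LWord m n} (hw : w.PrimeSign ε) : w.InSign ε :=
  ⟨[w], by simpa using hw, by simp⟩

lemma LWord.InSign.degree_and_suffixSign {ε : ℤ} (hε : ε = 1 ∨ ε = -1) {w : LWord m n}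
    (hw : w.InSign ε) : w.degree = 0 ∧ w.SuffixSign ε := by
  obtain ⟨ws, hws, rfl⟩ := hw
  induction ws with
  | nil => exact ⟨by simp, trivial⟩
  | cons u ws ih =>
    rw [List.forall_mem_cons] at hws
    obtain ⟨hd, hs⟩ := ih hws.2
    rw [List.flatten_cons, degree_append, suffixSign_append hd, hd, add_zero]
    exact ⟨(balanced_iff u).1 hws.1.1.2.1, hws.1.suffixSign hε, hs⟩

lemma LWord.inSign_of_suffixSign {ε : ℤ} (hε : ε = 1 ∨ ε = -1) (w : LWord m n)
    (hd : w.degree = 0) (hs : w.SuffixSign ε) : w.InSign ε := by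
  induction hlen : w.length using Nat.strong_induction_on generalizing w with
  | _ l ih =>
    subst hlen
    rcases eq_or_ne w [] with rfl | hw
    · exact ⟨[], by simp, rfl⟩
    by_cases hp : w.IsPrime
    · refine PrimeSign.inSign ⟨hp, ?_, ?_⟩
      · rcases w with _ | ⟨z, w⟩
        · exact absurd rfl hw
        refine ⟨z, rfl, (z.sign_eq_or hε).resolve_right fun hz => ?_⟩
        have h1 : ε * degree w ≤ 0 := by
          rcases w with _ | ⟨z', w⟩
          · simp
          · exact hs.2.1
        rw [degree_cons, hz] at hd
        rcases hε with rfl | rfl <;> omega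
      · obtain ⟨w', z, rfl⟩ := (List.eq_nil_or_concat' w).resolve_left hw
        refine ⟨z, by simp, (z.sign_eq_or hε).resolve_left fun hz => ?_⟩
        have h1 := hs.of_append.1
        rw [degree_cons, degree_nil, hz] at h1
        rcases hε with rfl | rfl <;> omega
    · have : ∃ u v : LWord m n, w = u ++ v ∧ u ≠ [] ∧ v ≠ [] ∧ u.Balanced := by
        by_contra! h
        exact hp ⟨hw, (balanced_iff w).2 hd, h⟩
      obtain ⟨u, v, rfl, hu, hv, hb⟩ := this
      rw [balanced_iff] at hb
      rw [degree_append, hb, zero_add] at hd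
      rw [suffixSign_append hd] at hs
      have hu' := List.length_pos_iff.2 hu
      have hv' := List.length_pos_iff.2 hv
      exact (ih u.length (by simp; omega) u hb hs.1 rfl).append
        (ih v.length (by simp; omega) v hd hs.2 rfl)

/-- The irreducible concatenations of prime words of type `ε` give a basis of the subalgebra
generated by the prime words of type `ε`. -/
lemma basis_inSign (K : Type) [Field K] (hm : 0 < m) (hn : 0 < n) {ε : ℤ}
    (hε : ε = 1 ∨ ε = -1) :
    LinearIndependent K
        (fun w : {w : LWord m n // w.Irr ∧ w.InSign ε} => wordToL K w.1) ∧
      Submodule.span K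
          (Set.range fun w : {w : LWord m n // w.Irr ∧ w.InSign ε} => wordToL K w.1) =
        Subalgebra.toSubmodule
          (Algebra.adjoin K {a | ∃ w : LWord m n, w.PrimeSign ε ∧ wordToL K w = a}) := by
  refine ⟨(linearIndependent_irr K hm hn).comp
    (fun w : {w : LWord m n // w.Irr ∧ w.InSign ε} => ⟨w.1, w.2.1⟩)
    fun a b h => Subtype.ext (Subtype.mk.inj h), le_antisymm ?_ ?_⟩
  · rw [Submodule.span_le]
    rintro _ ⟨⟨_, hirr, ws, hws, rfl⟩, rfl⟩
    simp only [SetLike.mem_coe, Subalgebra.mem_toSubmodule]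
    clear hirr
    induction ws with
    | nil => exact one_mem _
    | cons u ws ih =>
      rw [List.forall_mem_cons] at hws
      rw [List.flatten_cons, wordToL_append]
      exact mul_mem (Algebra.subset_adjoin ⟨u, hws.1, rfl⟩) (ih hws.2)
  · rw [Algebra.adjoin_eq_span, Submodule.span_le]
    intro a ha
    obtain ⟨w, hw, rfl⟩ : ∃ w : LWord m n, w.InSign ε ∧ wordToL K w = a := by
      induction ha using Submonoid.closure_induction with
      | mem a ha =>
        obtain ⟨w, hw, rfl⟩ := ha
        exact ⟨w, hw.inSign, rfl⟩
      | one => exact ⟨[], ⟨[], by simp, rfl⟩, rfl⟩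
      | mul a b _ _ iha ihb =>
        obtain ⟨u, hu, rfl⟩ := iha
        obtain ⟨v, hv, rfl⟩ := ihb
        exact ⟨u ++ v, hu.append hv, wordToL_append K u v⟩
    obtain ⟨hd, hs⟩ := hw.degree_and_suffixSign hε
    refine Submodule.span_mono ?_ (wordToL_mem_span_normalWords K w)
    rintro _ ⟨v, ⟨hirr, hvd, hvs⟩, rfl⟩
    exact ⟨⟨v, hirr, LWord.inSign_of_suffixSign hε v (hvd.trans hd) (hvs ε hs)⟩, rfl⟩

end Prime

/-- The images in `L(m,n)` of the words in `B^{xy} = B ∩ ⟨X⟩₀^{xy}` form a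
`K`-linear basis of `L(m,n)₀^{xy}`, and likewise the images of `B^{yx}` form a basis of
`L(m,n)₀^{yx}`. -/
theorem stmt8 (K : Type) [Field K] (m n : ℕ) (hm : 0 < m) (hn : 0 < n) :
    (LinearIndependent K
        (fun w : {w : LWord m n // w.Irr ∧ w.InXY} => wordToL K w.1) ∧
      Submodule.span K
          (Set.range fun w : {w : LWord m n // w.Irr ∧ w.InXY} => wordToL K w.1) =
        Subalgebra.toSubmodule (L0xy K m n)) ∧
    (LinearIndependent K
        (fun w : {w : LWord m n // w.Irr ∧ w.InYX} => wordToL K w.1) ∧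
      Submodule.span K
          (Set.range fun w : {w : LWord m n // w.Irr ∧ w.InYX} => wordToL K w.1) =
        Subalgebra.toSubmodule (L0yx K m n)) := by
  have hxy := basis_inSign (m := m) (n := n) K hm hn (Or.inl rfl)
  have hyx := basis_inSign (m := m) (n := n) K hm hn (Or.inr rfl)
  rw [LWord.inSign_one] at hxy
  rw [LWord.inSign_neg_one] at hyx
  simp only [LWord.primeSign_one_iff, and_assoc] at hxy
  simp only [LWord.primeSign_neg_one_iff, and_assoc] at hyx
  exact ⟨hxy, hyx⟩
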